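/- arXiv:1205.2286 — 2 statements merged into one kernel-verified Lean document; each statement's English description precedes it below -/
import Mathlib

section
/- Let p ∈ ℝ[x_1,…,x_d] be an RZ_{x⁰} polynomial with p(x⁰) > 0, let C be the closure in ℝ^d of the connected component of x⁰ in the set {x ∈ ℝ^d : p(x) > 0}, and let x' be a point of the interior of C. Then p(x') > 0 and p is an RZ_{x'} polynomial. -/
/-- A polynomial `p ∈ ℝ[x_1,…,x_d]` satisfies the real zero condition with respect to
`x⁰ ∈ ℝ^d` if for every `x ∈ ℝ^d`, every complex zero of the univariate polynomial
`t ↦ p(x⁰ + t·x)` is real. -/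
def IsRZ {d : ℕ} (p : MvPolynomial (Fin d) ℝ) (x0 : Fin d → ℝ) : Prop :=
  ∀ x : Fin d → ℝ, ∀ t : ℂ,
    MvPolynomial.aeval (fun i => (x0 i : ℂ) + t * (x i : ℂ)) p = 0 → t.im = 0

open Set Metric Filter Topology

/-- A continuous family of entire functions without zeros on a fixed circle which starts out
zero-free on the disc stays zero-free on the disc. -/
theorem ne_zero_on_closedBall_of_homotopy (h : ℝ → ℂ → ℂ)
    (hc : Continuous (Function.uncurry h)) (hd : ∀ s, Differentiable ℂ (h s)) (c : ℂ) (r : ℝ)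
    (hr : 0 < r) (hs : ∀ s ∈ Icc (0 : ℝ) 1, ∀ w ∈ sphere c r, h s w ≠ 0)
    (h0 : ∀ w ∈ closedBall c r, h 0 w ≠ 0) :
    ∀ s ∈ Icc (0 : ℝ) 1, ∀ w ∈ closedBall c r, h s w ≠ 0 := by
  obtain ⟨δ, hδ, hδs⟩ : ∃ δ > 0, ∀ s ∈ Icc (0 : ℝ) 1, ∀ w ∈ sphere c r, δ ≤ ‖h s w‖ := by
    have hK : IsCompact (Icc (0 : ℝ) 1 ×ˢ sphere c r) := isCompact_Icc.prod (isCompact_sphere c r)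
    have hne : (Icc (0 : ℝ) 1 ×ˢ sphere c r).Nonempty :=
      (nonempty_Icc.2 zero_le_one).prod (NormedSpace.sphere_nonempty.2 hr.le)
    obtain ⟨z, hz, hmin⟩ := hK.exists_isMinOn hne hc.norm.continuousOn
    refine ⟨‖h z.1 z.2‖, norm_pos_iff.2 (hs _ hz.1 _ hz.2), fun s hs w hw => ?_⟩
    exact hmin (show (s, w) ∈ Icc (0 : ℝ) 1 ×ˢ sphere c r from ⟨hs, hw⟩)
  have key : ∀ s ∈ Icc (0 : ℝ) 1, (∀ w ∈ closedBall c r, h s w ≠ 0) →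
      ∀ w ∈ closedBall c r, δ ≤ ‖h s w‖ := by
    intro s hsI hne w hw
    have hcl : closure (ball c r) = closedBall c r := closure_ball c hr.ne'
    have hdiff : DiffContOnCl ℂ (fun w => (h s w)⁻¹) (ball c r) :=
      (hd s).diffContOnCl.inv fun w hw => hne w (hcl ▸ hw)
    have := Complex.norm_le_of_forall_mem_frontier_norm_le (C := δ⁻¹) isBounded_ball hdiff
      (fun z hz => by
        rw [frontier_ball c hr.ne'] at hz
        rw [norm_inv]
        exact inv_anti₀ hδ (hδs s hsI z hz)) (hcl ▸ hw)
    rw [norm_inv] at this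
    exact (inv_le_inv₀ (norm_pos_iff.2 (hne w hw)) hδ).1 this
  have hsub : Icc (0 : ℝ) 1 ⊆ {s | ∀ w ∈ closedBall c r, δ ≤ ‖h s w‖} := by
    apply IsClosed.Icc_subset_of_forall_mem_nhdsWithin
    · refine IsClosed.inter ?_ isClosed_Icc
      simp only [ofPred_forall]
      refine isClosed_iInter fun w => isClosed_iInter fun _ => ?_
      exact isClosed_le continuous_const
        (hc.comp (continuous_id.prodMk continuous_const)).norm
    · exact key 0 ⟨le_rfl, zero_le_one⟩ h0
    · rintro s ⟨hsT, hsI⟩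
      have hev : ∀ᶠ s' in 𝓝 s, ∀ w ∈ closedBall c r, h s' w ≠ 0 := by
        apply (isCompact_closedBall c r).eventually_forall_of_forall_eventually
        intro w hw
        exact hc.continuousAt.eventually_ne (norm_pos_iff.1 (hδ.trans_le (hsT w hw)))
      filter_upwards [hev.filter_mono nhdsWithin_le_nhds, Ioo_mem_nhdsGT hsI.2] with s' h1 h2
      exact key s' ⟨hsI.1.trans h2.1.le, h2.2.le⟩ h1
  intro s hsI w hw
  exact norm_pos_iff.1 (hδ.trans_le (hsub hsI w hw))

namespace MvPolynomial

theorem continuous_aeval_complex {d : ℕ} (p : MvPolynomial (Fin d) ℝ) :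
    Continuous fun z : Fin d → ℂ => aeval z p := by
  induction p using MvPolynomial.induction_on with
  | C a => simpa using continuous_const
  | add p q hp hq => simp only [map_add]; exact hp.add hq
  | mul_X p i hp => simp only [map_mul, aeval_X]; exact hp.mul (continuous_apply i)

theorem differentiable_aeval_complex {d : ℕ} (p : MvPolynomial (Fin d) ℝ) (f : ℂ → Fin d → ℂ)
    (hf : ∀ i, Differentiable ℂ fun w => f w i) : Differentiable ℂ fun w => aeval (f w) p := by
  induction p using MvPolynomial.induction_on with
  | C a => simp
  | add p q hp hq => simp only [map_add]; exact hp.add hq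
  | mul_X p i hp => simp only [map_mul, aeval_X]; exact hp.mul (hf i)

theorem aeval_complex_ofReal {d : ℕ} (p : MvPolynomial (Fin d) ℝ) (x : Fin d → ℝ) :
    aeval (fun i => (x i : ℂ)) p = ((eval x p : ℝ) : ℂ) := by
  induction p using MvPolynomial.induction_on with
  | C a => simp
  | add p q hp hq => simp [hp, hq]
  | mul_X p i hp => simp [hp]

/-- The points that `x0` sees within the positivity set of `p`. -/
def positiveStar {d : ℕ} (p : MvPolynomial (Fin d) ℝ) (x0 : Fin d → ℝ) : Set (Fin d → ℝ) :=
  {y | ∀ l ∈ Icc (0 : ℝ) 1, 0 < eval (x0 + l • (y - x0)) p}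

variable {d : ℕ} {p : MvPolynomial (Fin d) ℝ} {x0 : Fin d → ℝ}

theorem isOpen_positiveStar : IsOpen (positiveStar p x0) := by
  rw [isOpen_iff_eventually]
  intro y hy
  apply isCompact_Icc.eventually_forall_of_forall_eventually
  intro l hl
  have : Continuous fun z : (Fin d → ℝ) × ℝ => eval (x0 + z.2 • (z.1 - x0)) p :=
    (MvPolynomial.continuous_eval p).comp (by fun_prop)
  exact this.continuousAt.eventually (lt_mem_nhds (hy l hl))

theorem eval_pos_of_mem_positiveStar {y : Fin d → ℝ} (hy : y ∈ positiveStar p x0) :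
    0 < eval y p := by
  simpa using hy 1 ⟨zero_le_one, le_rfl⟩

theorem base_mem_positiveStar (hpos : 0 < eval x0 p) : x0 ∈ positiveStar p x0 := by
  intro l _
  simpa using hpos

theorem smul_mem_positiveStar {y : Fin d → ℝ} (hy : y ∈ positiveStar p x0) {l : ℝ}
    (hl : l ∈ Icc (0 : ℝ) 1) : x0 + l • (y - x0) ∈ positiveStar p x0 := by
  intro m hm
  have := hy (m * l) ⟨mul_nonneg hm.1 hl.1, mul_le_one₀ hm.2 hl.1 hl.2⟩
  simpa [mul_smul] using this

end MvPolynomial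

open MvPolynomial

section

variable {d : ℕ} {p : MvPolynomial (Fin d) ℝ} {x0 : Fin d → ℝ}

/-- Zero-freeness on a disc tangent to the real line at the origin, after tilting the base point
`y` in an imaginary direction. -/
theorem IsRZ.aeval_tilt_ne_zero (hRZ : IsRZ p x0) {y : Fin d → ℝ} (hy : y ∈ positiveStar p x0)
    (v : Fin d → ℝ) {α : ℝ} (hα : 0 < α) {w : ℂ} (hw : α * Complex.normSq w ≤ -w.im) :
    aeval (fun i => (x0 i : ℂ) + (1 - Complex.I * α * w) * ((y i - x0 i : ℝ) : ℂ)
      + w * (v i : ℂ)) p ≠ 0 := by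
  set c : ℂ := ⟨0, -(2 * α)⁻¹⟩ with hc
  set r : ℝ := (2 * α)⁻¹ with hr
  have hr0 : 0 < r := by positivity
  have hαr : 2 * α * r = 1 := by rw [hr]; field_simp
  have hdist : ∀ z : ℂ, ‖z - c‖ ^ 2 = r ^ 2 + 2 * r * (α * Complex.normSq z + z.im) := by
    intro z
    rw [← Complex.normSq_eq_norm_sq, Complex.normSq_apply, Complex.normSq_apply]
    simp only [hc, Complex.sub_re, Complex.sub_im]
    linear_combination (-(z.re * z.re + z.im * z.im)) * hαr
  let h : ℝ → ℂ → ℂ := fun s w =>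
    aeval (fun i => (x0 i : ℂ) + (1 - Complex.I * α * w) * ((y i - x0 i : ℝ) : ℂ)
      + s * w * (v i : ℂ)) p
  have H := ne_zero_on_closedBall_of_homotopy h ?_ ?_ c r hr0 ?_ ?_ 1 ⟨zero_le_one, le_rfl⟩ w ?_
  · simpa [h] using H
  · refine (continuous_aeval_complex p).comp (g := fun z : Fin d → ℂ => aeval z p)
      (f := fun q : ℝ × ℂ => fun i => (x0 i : ℂ) +
        (1 - Complex.I * α * q.2) * ((y i - x0 i : ℝ) : ℂ) + q.1 * q.2 * (v i : ℂ)) ?_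
    fun_prop
  · intro s
    refine differentiable_aeval_complex p _ fun i => ?_
    fun_prop
  · intro s _ z hz hzero
    have hz2 : α * Complex.normSq z + z.im = 0 := by
      have h1 := hdist z
      rw [mem_sphere_iff_norm.1 hz] at h1
      have : 2 * r * (α * Complex.normSq z + z.im) = 0 := by linarith
      simpa [hr0.ne'] using this
    by_cases hz0 : z = 0
    · have h1 := eval_pos_of_mem_positiveStar hy
      subst hz0
      have h2 := aeval_complex_ofReal p y
      simp [h] at hzero
      rw [hzero] at h2
      exact h1.ne (by exact_mod_cast h2)
    · have hn : Complex.normSq z ≠ 0 := by simpa using hz0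
      set t : ℝ := z.re / Complex.normSq z with ht
      have htn : t * Complex.normSq z = z.re := by rw [ht]; field_simp
      have hsq : Complex.normSq z = z.re * z.re + z.im * z.im := Complex.normSq_apply z
      have htz : 1 - Complex.I * α * z = t * z := by
        apply Complex.ext
        · simp
          apply mul_right_cancel₀ hn
          linear_combination (-z.re) * htn + z.im * hz2 + hsq
        · simp
          apply mul_right_cancel₀ hn
          linear_combination (-z.im) * htn - z.re * hz2
      have him := hRZ (fun i => t * (y i - x0 i) + s * v i) z (by
        rw [← hzero]
        simp only [h]
        congr 2
        funext i
        rw [htz]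
        push_cast
        ring)
      rw [him, add_zero] at hz2
      exact hn (by simpa [hα.ne'] using hz2)
  · intro z hz hzero
    have hz2 : α * Complex.normSq z + z.im ≤ 0 := by
      have h1 := hdist z
      have h2 : ‖z - c‖ ^ 2 ≤ r ^ 2 :=
        pow_le_pow_left₀ (norm_nonneg _) (mem_closedBall_iff_norm.1 hz) 2
      have : 2 * r * (α * Complex.normSq z + z.im) ≤ 0 := by linarith
      by_contra! hcon
      have := mul_pos (mul_pos two_pos hr0) hcon
      linarith
    have him := hRZ (fun i => y i - x0 i) (1 - Complex.I * α * z) (by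
      rw [← hzero]; simp [h])
    have hre : z.re = 0 := by simpa [hα.ne'] using him
    have hl : 1 - Complex.I * α * z = ((1 + α * z.im : ℝ) : ℂ) := by
      apply Complex.ext <;> simp [hre]
    rw [Complex.normSq_apply, hre] at hz2
    have hz3 : z.im ≤ 0 := by nlinarith [mul_self_nonneg z.im]
    have hz4 : 0 ≤ 1 + α * z.im := by
      rcases hz3.eq_or_lt with h' | h'
      · simp [h']
      · by_contra! hcon
        nlinarith
    have h1 := hy (1 + α * z.im) ⟨hz4, by nlinarith⟩
    have h2 := aeval_complex_ofReal p (x0 + (1 + α * z.im) • (y - x0))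
    have h3 : h 0 z = aeval (fun i => ((x0 + (1 + α * z.im) • (y - x0)) i : ℂ)) p := by
      simp only [h]
      congr 2
      funext i
      rw [hl]
      simp
    rw [← h3, hzero] at h2
    exact h1.ne (by exact_mod_cast h2)
  · rw [mem_closedBall_iff_norm]
    refine le_of_sq_le_sq ?_ hr0.le
    rw [hdist]
    nlinarith

theorem IsRZ.of_mem_positiveStar (hRZ : IsRZ p x0) {y : Fin d → ℝ}
    (hy : y ∈ positiveStar p x0) : IsRZ p y := by
  have lower : ∀ (x : Fin d → ℝ) (t : ℂ), t.im < 0 →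
      aeval (fun i => (y i : ℂ) + t * (x i : ℂ)) p ≠ 0 := by
    intro x t ht
    obtain ⟨μ, hμ, hμy⟩ : ∃ μ : ℝ, 1 < μ ∧ x0 + μ • (y - x0) ∈ positiveStar p x0 := by
      have hcont : Continuous fun μ : ℝ => x0 + μ • (y - x0) := by fun_prop
      have hev : ∀ᶠ μ in 𝓝 (1 : ℝ), x0 + μ • (y - x0) ∈ positiveStar p x0 :=
        hcont.continuousAt.eventually (isOpen_positiveStar.mem_nhds (by simpa using hy))
      obtain ⟨μ, h1, h2⟩ :=
        ((hev.filter_mono nhdsWithin_le_nhds).and (self_mem_nhdsWithin (s := Ioi 1))).exists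
      exact ⟨μ, h2, h1⟩
    have hn : 0 < Complex.normSq t := Complex.normSq_pos.2 fun h => by simp [h] at ht
    have hμ0 : 0 < μ := by linarith
    have hμ1 : 0 < 1 - μ⁻¹ := sub_pos.2 (inv_lt_one_of_one_lt₀ hμ)
    set α : ℝ := -t.im * (1 - μ⁻¹) / Complex.normSq t with hα
    have hα0 : 0 < α := div_pos (mul_pos (neg_pos.2 ht) hμ1) hn
    have hαn : α * Complex.normSq t = -t.im * (1 - μ⁻¹) := by rw [hα]; field_simp
    set B : ℝ := -(α * t.re) / t.im with hB
    have hBt : B * t.im = -(α * t.re) := by rw [hB]; field_simp [ht.ne]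
    have hdec : 1 - Complex.I * α * t = (μ⁻¹ : ℝ) + B * t := by
      apply Complex.ext
      · rw [Complex.normSq_apply] at hαn
        simp
        apply mul_right_cancel₀ ht.ne
        linear_combination hαn - t.re * hBt
      · simp
        linear_combination -hBt
    have key := hRZ.aeval_tilt_ne_zero hμy (fun i => x i - B * (μ * (y i - x0 i))) hα0 (w := t) (by
      rw [hαn]
      have : 0 < μ⁻¹ := inv_pos.2 hμ0
      nlinarith)
    rw [hdec] at key
    convert key using 3
    funext i
    have : (μ : ℂ) ≠ 0 := by exact_mod_cast hμ0.ne'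
    simp
    field_simp
    ring
  intro x t h0
  rcases lt_trichotomy t.im 0 with h | h | h
  · exact absurd h0 (lower x t h)
  · exact h
  · refine absurd ?_ (lower (-x) (-t) (by simpa using h))
    simpa using h0

theorem IsRZ.convex_positiveStar (hRZ : IsRZ p x0) (hpos : 0 < eval x0 p) :
    Convex ℝ (positiveStar p x0) := by
  rw [convex_iff_add_mem]
  intro y hy z hz a b ha hb hab
  let h : ℝ → ℂ → ℂ := fun l t =>
    aeval (fun i => ((x0 + l • (y - x0)) i : ℂ) + t * ((l • (z - y)) i : ℝ)) p
  have H := ne_zero_on_closedBall_of_homotopy h ?_ ?_ (1 / 2) (1 / 2) (by norm_num) ?_ ?_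
  · have hb' : (b : ℂ) ∈ closedBall (1 / 2 : ℂ) (1 / 2) := by
      rw [mem_closedBall_iff_norm]
      have : (b : ℂ) - 1 / 2 = ((b - 1 / 2 : ℝ) : ℂ) := by push_cast; ring
      rw [this, Complex.norm_real, Real.norm_eq_abs, abs_le]
      constructor <;> linarith
    have hne : ∀ l ∈ Icc (0 : ℝ) 1, eval (x0 + l • (a • y + b • z - x0)) p ≠ 0 := by
      intro l hl h0
      apply H l hl b hb'
      have := aeval_complex_ofReal p (x0 + l • (a • y + b • z - x0))
      rw [h0, Complex.ofReal_zero] at this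
      rw [← this]
      simp only [h]
      congr 2
      funext i
      obtain rfl : a = 1 - b := by linarith
      simp
      ring
    intro l hl
    by_contra! hle
    have hcont : Continuous fun l : ℝ => eval (x0 + l • (a • y + b • z - x0)) p :=
      (MvPolynomial.continuous_eval p).comp (by fun_prop)
    obtain ⟨m, hm, hm0⟩ := intermediate_value_Icc' hl.1 hcont.continuousOn
      (show (0 : ℝ) ∈ _ from ⟨hle, by simpa using hpos.le⟩)
    exact hne m ⟨hm.1, hm.2.trans hl.2⟩ hm0
  · refine (continuous_aeval_complex p).comp (g := fun z : Fin d → ℂ => aeval z p)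
      (f := fun q : ℝ × ℂ => fun i => ((x0 + q.1 • (y - x0)) i : ℂ)
        + q.2 * ((q.1 • (z - y)) i : ℝ)) ?_
    simp only [Pi.add_apply, Pi.smul_apply, smul_eq_mul]
    fun_prop
  · intro s
    refine differentiable_aeval_complex p _ fun i => ?_
    fun_prop
  · intro l hl t ht h0
    have him := hRZ.of_mem_positiveStar (smul_mem_positiveStar hy hl) _ t h0
    have hre : t.re * (t.re - 1) = 0 := by
      have h1 : ‖t - 1 / 2‖ ^ 2 = (1 / 2) ^ 2 := by rw [mem_sphere_iff_norm.1 ht]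
      rw [← Complex.normSq_eq_norm_sq, Complex.normSq_apply] at h1
      simp [him] at h1
      linarith
    rcases mul_eq_zero.1 hre with h1 | h1
    · have ht0 : t = 0 := Complex.ext h1 him
      have h2 := aeval_complex_ofReal p (x0 + l • (y - x0))
      have h3 : h l t = aeval (fun i => ((x0 + l • (y - x0)) i : ℂ)) p := by simp [h, ht0]
      rw [← h3, h0] at h2
      exact (hy l hl).ne (by exact_mod_cast h2)
    · have ht1 : t = 1 := Complex.ext (by simpa using sub_eq_zero.1 h1) him
      have h2 := aeval_complex_ofReal p (x0 + l • (z - x0))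
      have h3 : h l t = aeval (fun i => ((x0 + l • (z - x0)) i : ℂ)) p := by
        simp only [h, ht1]
        congr 2
        funext i
        simp
        ring
      rw [← h3, h0] at h2
      exact (hz l hl).ne (by exact_mod_cast h2)
  · intro t _ h0
    have h2 := aeval_complex_ofReal p x0
    have h3 : h 0 t = aeval (fun i => (x0 i : ℂ)) p := by simp [h]
    rw [← h3, h0] at h2
    exact hpos.ne (by exact_mod_cast h2)

theorem IsRZ.connectedComponentIn_subset_positiveStar (hRZ : IsRZ p x0) (hpos : 0 < eval x0 p) :
    connectedComponentIn {x : Fin d → ℝ | 0 < eval x p} x0 ⊆ positiveStar p x0 := by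
  have hint : interior (positiveStar p x0) = positiveStar p x0 := isOpen_positiveStar.interior_eq
  have hx0 := base_mem_positiveStar hpos
  refine isPreconnected_connectedComponentIn.subset_of_closure_inter_subset isOpen_positiveStar
    ⟨x0, mem_connectedComponentIn hpos, hx0⟩ ?_
  rintro y ⟨hycl, hyC⟩ l hl
  have hy : y ∈ {x : Fin d → ℝ | 0 < eval x p} := connectedComponentIn_subset _ _ hyC
  rw [mem_ofPred_eq] at hy
  rcases hl.2.eq_or_lt with rfl | hl1
  · simpa using hy
  · have hmem : x0 + l • (y - x0) ∈ interior (positiveStar p x0) := by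
      have := (hRZ.convex_positiveStar hpos).combo_interior_closure_mem_interior
        (hint.symm ▸ hx0) hycl (a := 1 - l) (b := l) (by linarith) hl.1 (by ring)
      convert this using 1
      module
    exact eval_pos_of_mem_positiveStar (interior_subset hmem)

end

/-- If `p` is an `RZ_{x⁰}` polynomial with `p(x⁰) > 0` and `x'` is interior to the
closure `C` of the connected component of `x⁰` in `{p > 0}`, then `p(x') > 0` and
`p` is also an `RZ_{x'}` polynomial. -/
theorem stmt3 {d : ℕ} (p : MvPolynomial (Fin d) ℝ) (x0 : Fin d → ℝ)
    (hRZ : IsRZ p x0) (hpos : 0 < MvPolynomial.eval x0 p) (x' : Fin d → ℝ)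
    (hx' : x' ∈ interior (closure (connectedComponentIn
      {x : Fin d → ℝ | 0 < MvPolynomial.eval x p} x0))) :
    0 < MvPolynomial.eval x' p ∧ IsRZ p x' := by
  have hint : interior (positiveStar p x0) = positiveStar p x0 := isOpen_positiveStar.interior_eq
  have hmem : x' ∈ positiveStar p x0 := by
    have h := interior_mono
      (closure_mono (hRZ.connectedComponentIn_subset_positiveStar hpos)) hx'
    rwa [(hRZ.convex_positiveStar hpos).interior_closure_eq_interior_of_nonempty_interior
      (hint.symm ▸ ⟨x0, base_mem_positiveStar hpos⟩), hint] at h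
  exact ⟨eval_pos_of_mem_positiveStar hmem, hRZ.of_mem_positiveStar hmem⟩
end

section
/- Let p ∈ ℝ[x_1,…,x_d] be an RZ_{x⁰} polynomial of degree m with p(x⁰) > 0, and let C be the closure in ℝ^d of the connected component of x⁰ in {x ∈ ℝ^d : p(x) > 0}. Then C = {x ∈ ℝ^d : p(x) ≥ 0, p^{(1)}_{x⁰}(x) ≥ 0, …, p^{(m−1)}_{x⁰}(x) ≥ 0}, where p^{(k)}_{x⁰} denotes the k-th Renegar derivative of p with respect to x⁰; in particular C is a basic closed semialgebraic set. -/
/-- The homogenization `P(X_0, X_1, …, X_d) = X_0^m · p(X_1/X_0, …, X_d/X_0)` of a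
polynomial `p` of degree (at most) `m`; the variable `0 : Fin (d+1)` is the
homogenizing variable `X_0` and the variable `i.succ` corresponds to `x_i`. -/
noncomputable def homogenize {d : ℕ} (m : ℕ) (p : MvPolynomial (Fin d) ℝ) :
    MvPolynomial (Fin (d + 1)) ℝ :=
  ∑ k ∈ p.support,
    MvPolynomial.monomial
      (Finsupp.mapDomain Fin.succ k + Finsupp.single 0 (m - k.sum fun _ e => e))
      (MvPolynomial.coeff k p)

/-- The `k`-th Renegar derivative of `p` (of degree `m`) with respect to `x⁰`:
`p^{(k)}_{x⁰}(x) = (d^k/ds^k) P(X + sX⁰)|_{s=0}` evaluated at `X = (1, x)`, where `P`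
is the homogenization of `p` and `X⁰ = (1, x⁰)`. -/
noncomputable def renegarDeriv {d : ℕ} (m : ℕ) (p : MvPolynomial (Fin d) ℝ)
    (x0 : Fin d → ℝ) (k : ℕ) : MvPolynomial (Fin d) ℝ :=
  MvPolynomial.aeval (Fin.cons (1 : MvPolynomial (Fin d) ℝ) MvPolynomial.X)
    (Polynomial.eval 0
      ((fun q => Polynomial.derivative q)^[k]
        (MvPolynomial.aeval
          (fun α => Polynomial.C (MvPolynomial.X α) +
            Polynomial.X * Polynomial.C (MvPolynomial.C (Fin.cons (1 : ℝ) x0 α)))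
          (homogenize m p))))

open Polynomial in
/-- The restriction of `p` to the line through `x0` and `x`, parametrized so that `0 ↦ x0`
and `1 ↦ x`. -/
noncomputable def linePoly {d : ℕ} (p : MvPolynomial (Fin d) ℝ) (x0 x : Fin d → ℝ) : ℝ[X] :=
  MvPolynomial.aeval (fun i => C (x0 i) + X * C (x i - x0 i)) p

open Polynomial in
/-- The polynomial `s ↦ P(X + s X⁰)` at `X = (1, x)`, where `P` is the homogenization of `p` and
`X⁰ = (1, x0)`. -/
noncomputable def renegarPoly {d : ℕ} (m : ℕ) (p : MvPolynomial (Fin d) ℝ)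
    (x0 x : Fin d → ℝ) : ℝ[X] :=
  taylor 1 (reflect m (linePoly p x0 x))

open Polynomial in
theorem natDegree_linePoly_le {d : ℕ} (p : MvPolynomial (Fin d) ℝ) (x0 x : Fin d → ℝ) :
    (linePoly p x0 x).natDegree ≤ p.totalDegree := by
  have h := MvPolynomial.aeval_natDegree_le (n := 1) p le_rfl
    (fun i => C (x0 i) + X * C (x i - x0 i)) fun i => by compute_degree
  simpa [linePoly] using h

open Polynomial in
theorem aeval_linePoly {d : ℕ} {A : Type*} [CommRing A] [Algebra ℝ A]
    (p : MvPolynomial (Fin d) ℝ) (x0 x : Fin d → ℝ) (t : A) :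
    aeval t (linePoly p x0 x) =
      MvPolynomial.aeval
        (fun i => algebraMap ℝ A (x0 i) + t * algebraMap ℝ A (x i - x0 i)) p := by
  rw [linePoly, ← AlgHom.comp_apply, MvPolynomial.comp_aeval]
  simp

open Polynomial in
theorem eval_linePoly {d : ℕ} (p : MvPolynomial (Fin d) ℝ) (x0 x : Fin d → ℝ) (t : ℝ) :
    (linePoly p x0 x).eval t = MvPolynomial.eval (fun i => x0 i + t * (x i - x0 i)) p := by
  have h := aeval_linePoly p x0 x t
  simpa [MvPolynomial.aeval_eq_eval] using h

theorem eval_homogenize {d m : ℕ} (p : MvPolynomial (Fin d) ℝ) (hdeg : p.totalDegree ≤ m)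
    {c : ℝ} (hc : c ≠ 0) (y : Fin d → ℝ) :
    MvPolynomial.eval (Fin.cons c y) (homogenize m p) =
      c ^ m * MvPolynomial.eval (fun i => c⁻¹ * y i) p := by
  rw [homogenize, map_sum, MvPolynomial.eval_eq, Finset.mul_sum]
  refine Finset.sum_congr rfl fun k hk => ?_
  have hk' : k.sum (fun _ e => e) ≤ m := (MvPolynomial.le_totalDegree hk).trans hdeg
  rw [MvPolynomial.eval_monomial, Finsupp.prod_add_index' (by simp) (by simp [pow_add]),
    Finsupp.prod_mapDomain_index (by simp) (by simp [pow_add]),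
    Finsupp.prod_single_index (by simp)]
  simp only [Fin.cons_succ, Fin.cons_zero, mul_pow, Finset.prod_mul_distrib]
  rw [Finset.prod_pow_eq_pow_sum, Finsupp.prod]
  have h : c ^ m = c ^ (m - k.sum fun _ e => e) * c ^ (∑ i ∈ k.support, k i) := by
    rw [← pow_add]
    congr 1
    exact (Nat.sub_add_cancel hk').symm
  rw [h, inv_pow]
  field_simp

open Polynomial in
theorem eval_renegarPoly {d m : ℕ} (p : MvPolynomial (Fin d) ℝ) (hdeg : p.totalDegree ≤ m)
    (x0 x : Fin d → ℝ) {s : ℝ} (hs : s + 1 ≠ 0) :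
    (renegarPoly m p x0 x).eval s = (s + 1) ^ m * (linePoly p x0 x).eval (s + 1)⁻¹ := by
  let _ : Invertible (s + 1)⁻¹ := invertibleOfNonzero (inv_ne_zero hs)
  have h := eval₂_reflect_mul_pow (RingHom.id ℝ) (s + 1)⁻¹ m (linePoly p x0 x)
    ((natDegree_linePoly_le p x0 x).trans hdeg)
  rw [invOf_eq_inv, inv_inv, ← eval, ← eval] at h
  rw [renegarPoly, taylor_eval, ← h, inv_pow]
  field_simp

open Polynomial in
theorem aeval_homogenize_eq_renegarPoly {d m : ℕ} (p : MvPolynomial (Fin d) ℝ)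
    (hdeg : p.totalDegree ≤ m) (x0 x : Fin d → ℝ) :
    MvPolynomial.aeval (fun α => C ((Fin.cons 1 x : Fin (d + 1) → ℝ) α) +
      X * C ((Fin.cons 1 x0 : Fin (d + 1) → ℝ) α)) (homogenize m p) = renegarPoly m p x0 x := by
  refine eq_of_infinite_eval_eq _ _ ((Set.Ioi_infinite (0 : ℝ)).mono fun s hs => ?_)
  have hs' : s + 1 ≠ 0 := by have : 0 < s := hs; positivity
  rw [Set.mem_ofPred_eq, eval_renegarPoly p hdeg x0 x hs', eval_linePoly]
  have h : (fun α => (Fin.cons 1 x : Fin (d + 1) → ℝ) α +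
      s * (Fin.cons 1 x0 : Fin (d + 1) → ℝ) α) =
      (Fin.cons (s + 1) (fun i => s * x0 i + x i) : Fin (d + 1) → ℝ) := by
    ext α
    refine Fin.cases ?_ (fun i => ?_) α <;> simp [add_comm]
  have h2 := eval_homogenize p hdeg hs' (fun i => s * x0 i + x i)
  rw [← h] at h2
  have h3 : (fun i => (s + 1)⁻¹ * (s * x0 i + x i)) =
      fun i => x0 i + (s + 1)⁻¹ * (x i - x0 i) := by
    ext i
    field_simp
    ring
  rw [h3] at h2
  rw [← h2, ← coe_aeval_eq_eval, ← AlgHom.comp_apply, MvPolynomial.comp_aeval,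
    ← MvPolynomial.aeval_eq_eval]
  simp [mul_comm s]

open Polynomial in
theorem eval_renegarDeriv {d m : ℕ} (p : MvPolynomial (Fin d) ℝ) (hdeg : p.totalDegree ≤ m)
    (x0 x : Fin d → ℝ) (k : ℕ) :
    MvPolynomial.eval x (renegarDeriv m p x0 k) = k.factorial * (renegarPoly m p x0 x).coeff k := by
  let φ : MvPolynomial (Fin (d + 1)) ℝ →ₐ[ℝ] ℝ := (MvPolynomial.aeval x).comp
    (MvPolynomial.aeval (Fin.cons (1 : MvPolynomial (Fin d) ℝ) MvPolynomial.X))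
  have hφ (α : Fin (d + 1)) :
      φ (MvPolynomial.X α) = (Fin.cons 1 x : Fin (d + 1) → ℝ) α := by
    refine Fin.cases ?_ (fun i => ?_) α <;> simp [φ]
  have hmap (F : MvPolynomial (Fin (d + 1)) ℝ) :
      mapAlgHom φ (MvPolynomial.aeval (fun α => C (MvPolynomial.X α) +
        X * C (MvPolynomial.C (Fin.cons (1 : ℝ) x0 α))) F) =
      MvPolynomial.aeval (fun α => C ((Fin.cons 1 x : Fin (d + 1) → ℝ) α) +
        X * C ((Fin.cons 1 x0 : Fin (d + 1) → ℝ) α)) F := by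
    rw [← AlgHom.comp_apply, MvPolynomial.comp_aeval]
    congr 2
    ext1 α
    have hC (r : ℝ) : φ (MvPolynomial.C r) = r := φ.commutes r
    simp [hφ, hC]
  rw [← aeval_homogenize_eq_renegarPoly p hdeg, ← hmap, coe_mapAlgHom, coeff_map]
  simp only [renegarDeriv, ← coeff_zero_eq_eval_zero, coeff_iterate_derivative, zero_add,
    Nat.descFactorial_self, nsmul_eq_mul, map_mul, map_natCast]
  rfl

open Polynomial in
theorem coeff_renegarPoly_zero {d m : ℕ} (p : MvPolynomial (Fin d) ℝ) (hdeg : p.totalDegree ≤ m)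
    (x0 x : Fin d → ℝ) : (renegarPoly m p x0 x).coeff 0 = MvPolynomial.eval x p := by
  rw [coeff_zero_eq_eval_zero, eval_renegarPoly p hdeg x0 x (by norm_num), eval_linePoly]
  simp

open Polynomial in
theorem natDegree_renegarPoly_le {d m : ℕ} (p : MvPolynomial (Fin d) ℝ)
    (hdeg : p.totalDegree ≤ m) (x0 x : Fin d → ℝ) : (renegarPoly m p x0 x).natDegree ≤ m := by
  rw [renegarPoly, natDegree_taylor, natDegree_le_iff_coeff_eq_zero]
  intro N hN
  rw [coeff_reflect, revAt_eq_self_of_lt hN]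
  exact coeff_eq_zero_of_natDegree_lt (((natDegree_linePoly_le p x0 x).trans hdeg).trans_lt hN)

open Polynomial in
theorem coeff_renegarPoly_self {d m : ℕ} (p : MvPolynomial (Fin d) ℝ) (hdeg : p.totalDegree ≤ m)
    (x0 x : Fin d → ℝ) : (renegarPoly m p x0 x).coeff m = MvPolynomial.eval x0 p := by
  have h : (reflect m (linePoly p x0 x)).natDegree ≤ m := by
    simpa [renegarPoly, natDegree_taylor] using natDegree_renegarPoly_le p hdeg x0 x
  have h0 : (linePoly p x0 x).coeff 0 = MvPolynomial.eval x0 p := by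
    rw [coeff_zero_eq_eval_zero, eval_linePoly]
    simp
  have h1 : (reflect m (linePoly p x0 x)).coeff m = (linePoly p x0 x).coeff 0 := by
    simp [coeff_reflect]
  rw [← h0, ← h1, renegarPoly]
  obtain h | h := h.lt_or_eq
  · rw [coeff_eq_zero_of_natDegree_lt h, coeff_eq_zero_of_natDegree_lt (by simpa using h)]
  · have h2 := coeff_taylor_natDegree (f := reflect m (linePoly p x0 x)) (r := 1)
    rwa [leadingCoeff, h] at h2

open Polynomial in
theorem splits_renegarPoly {d m : ℕ} {p : MvPolynomial (Fin d) ℝ} (hdeg : p.totalDegree ≤ m)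
    {x0 : Fin d → ℝ} (hRZ : IsRZ p x0) (x : Fin d → ℝ) : (renegarPoly m p x0 x).Splits := by
  refine Splits.taylor ?_ 1
  refine Splits.of_splits_map (algebraMap ℝ ℂ) (IsAlgClosed.splits _) fun u hu => ?_
  suffices h : u.im = 0 from ⟨u.re, Complex.ext rfl (by simp [h])⟩
  by_cases hu0 : u = 0
  · simp [hu0]
  let _ : Invertible u⁻¹ := invertibleOfNonzero (inv_ne_zero hu0)
  have hroot : eval₂ (algebraMap ℝ ℂ) (⅟u⁻¹) (reflect m (linePoly p x0 x)) = 0 := by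
    rw [invOf_eq_inv, inv_inv, ← eval_map]
    exact (mem_roots'.1 hu).2
  rw [eval₂_reflect_eq_zero_iff _ _ _ _ ((natDegree_linePoly_le p x0 x).trans hdeg),
    ← aeval_def, aeval_linePoly] at hroot
  have him := hRZ (fun i => x i - x0 i) u⁻¹ (by simpa using hroot)
  rw [Complex.inv_im, div_eq_zero_iff] at him
  simpa [hu0] using him

open Polynomial in
theorem coeff_multiset_prod_X_add_C_pos (s : Multiset ℝ) (hs : ∀ a ∈ s, 0 < a)
    {k : ℕ} (hk : k ≤ s.card) : 0 < (s.map fun a => X + C a).prod.coeff k := by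
  rw [Multiset.prod_X_add_C_coeff s hk, Multiset.esymm]
  rw [← Multiset.sum_toList]
  refine List.sum_pos _ (fun b hb => ?_) ?_
  · rw [Multiset.mem_toList] at hb
    obtain ⟨t, ht, rfl⟩ := Multiset.mem_map.1 hb
    exact Multiset.prod_pos fun a ha =>
      hs a (Multiset.mem_of_le (Multiset.mem_powersetCard.1 ht).1 ha)
  · rw [Ne, Multiset.toList_eq_nil, ← Ne, ← Multiset.card_pos, Multiset.card_map, Multiset.card_powersetCard]
    exact Nat.choose_pos (Nat.sub_le _ _)

open Polynomial in
/-- A real-rooted polynomial with nonnegative coefficients whose constant and leading coefficients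
are positive has only positive coefficients. -/
theorem Polynomial.Splits.coeff_pos_of_nonneg {f : ℝ[X]} (hf : f.Splits)
    (h0 : 0 < f.coeff 0) (hlead : 0 < f.leadingCoeff) (hnn : ∀ k, 0 ≤ f.coeff k)
    {k : ℕ} (hk : k ≤ f.natDegree) : 0 < f.coeff k := by
  have hroots : ∀ a ∈ f.roots.map Neg.neg, 0 < a := by
    intro a ha
    obtain ⟨b, hb, rfl⟩ := Multiset.mem_map.1 ha
    by_contra! hneg
    have hb0 : 0 ≤ b := by linarith
    have hev : f.eval b = 0 := (mem_roots'.1 hb).2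
    have : f.coeff 0 ≤ f.eval b := by
      rw [eval_eq_sum_range]
      have h := Finset.single_le_sum (f := fun i => f.coeff i * b ^ i)
        (fun i _ => mul_nonneg (hnn i) (pow_nonneg hb0 i))
        (Finset.mem_range.2 (Nat.succ_pos f.natDegree))
      simpa using h
    linarith
  have hprod := hf.eq_prod_roots
  have hmap : (f.roots.map fun a => X - C a) =
      ((f.roots.map Neg.neg).map fun a => X + C a) := by
    simp [Multiset.map_map, sub_eq_add_neg]
  rw [hmap] at hprod
  rw [hprod, coeff_C_mul]
  refine mul_pos hlead (coeff_multiset_prod_X_add_C_pos _ hroots ?_)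
  rwa [Multiset.card_map, ← hf.natDegree_eq_card_roots]

/-- A polynomial with nonnegative coefficients and a positive coefficient is positive on the
positive half-line. -/
theorem Polynomial.eval_pos_of_coeff_nonneg {f : Polynomial ℝ} (hnn : ∀ k, 0 ≤ f.coeff k)
    {m : ℕ} (hm : 0 < f.coeff m) {s : ℝ} (hs : 0 < s) : 0 < f.eval s := by
  rw [eval_eq_sum_range]
  refine Finset.sum_pos' (fun i _ => mul_nonneg (hnn i) (pow_nonneg hs.le i)) ⟨m, ?_, ?_⟩
  · exact Finset.mem_range_succ_iff.2 (le_natDegree_of_ne_zero hm.ne')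
  · exact mul_pos hm (pow_pos hs m)

theorem renegar_nonneg_iff {d m : ℕ} (p : MvPolynomial (Fin d) ℝ) (hdeg : p.totalDegree ≤ m)
    {x0 : Fin d → ℝ} (hpos : 0 < MvPolynomial.eval x0 p) (x : Fin d → ℝ) :
    (0 ≤ MvPolynomial.eval x p ∧ ∀ k ∈ Finset.Icc 1 (m - 1),
      0 ≤ MvPolynomial.eval x (renegarDeriv m p x0 k)) ↔
      ∀ k, 0 ≤ (renegarPoly m p x0 x).coeff k := by
  have hk (k : ℕ) : 0 ≤ MvPolynomial.eval x (renegarDeriv m p x0 k) ↔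
      0 ≤ (renegarPoly m p x0 x).coeff k := by
    rw [eval_renegarDeriv p hdeg]
    exact mul_nonneg_iff_of_pos_left (by positivity)
  simp only [hk, ← coeff_renegarPoly_zero p hdeg x0 x]
  refine ⟨fun h k => ?_, fun h => ⟨h 0, fun k _ => h k⟩⟩
  rcases Nat.eq_zero_or_pos k with rfl | hk0
  · exact h.1
  rcases lt_trichotomy k m with hkm | rfl | hkm
  · exact h.2 k (Finset.mem_Icc.2 ⟨hk0, by omega⟩)
  · rw [coeff_renegarPoly_self p hdeg]
    exact hpos.le
  · rw [Polynomial.coeff_eq_zero_of_natDegree_lt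
      ((natDegree_renegarPoly_le p hdeg x0 x).trans_lt hkm)]

/-- Along the connected component of `x0` in `{p > 0}`, all coefficients of `s ↦ P(X + s X⁰)` stay
positive. -/
theorem coeff_renegarPoly_pos_of_mem_component {d m : ℕ} {p : MvPolynomial (Fin d) ℝ}
    (hdeg : p.totalDegree ≤ m) {x0 : Fin d → ℝ} (hRZ : IsRZ p x0)
    (hpos : 0 < MvPolynomial.eval x0 p) {x : Fin d → ℝ}
    (hx : x ∈ connectedComponentIn {x : Fin d → ℝ | 0 < MvPolynomial.eval x p} x0) :
    ∀ k ≤ m, 0 < (renegarPoly m p x0 x).coeff k := by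
  have hcont (k : ℕ) : Continuous fun y => (renegarPoly m p x0 y).coeff k := by
    have h : (fun y => (renegarPoly m p x0 y).coeff k) = fun y =>
        (k.factorial : ℝ)⁻¹ * MvPolynomial.eval y (renegarDeriv m p x0 k) := by
      ext y
      rw [eval_renegarDeriv p hdeg, inv_mul_cancel_left₀ (by positivity)]
    rw [h]
    exact continuous_const.mul (MvPolynomial.continuous_eval _)
  have hstrict {y : Fin d → ℝ} (hy : 0 < MvPolynomial.eval y p)
      (hnn : ∀ k ≤ m, 0 ≤ (renegarPoly m p x0 y).coeff k) :
      ∀ k ≤ m, 0 < (renegarPoly m p x0 y).coeff k := by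
    have hm : 0 < (renegarPoly m p x0 y).coeff m := by rwa [coeff_renegarPoly_self p hdeg]
    have hnat : (renegarPoly m p x0 y).natDegree = m :=
      le_antisymm (natDegree_renegarPoly_le p hdeg x0 y)
        (Polynomial.le_natDegree_of_ne_zero hm.ne')
    intro k hk
    refine (splits_renegarPoly hdeg hRZ y).coeff_pos_of_nonneg ?_ ?_ (fun j => ?_) (by rwa [hnat])
    · rwa [coeff_renegarPoly_zero p hdeg]
    · rwa [Polynomial.leadingCoeff, hnat]
    · rcases le_or_gt j m with hj | hj
      · exact hnn j hj
      · rw [Polynomial.coeff_eq_zero_of_natDegree_lt (by rwa [hnat])]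
  have hx0 : ∀ k ≤ m, 0 < (renegarPoly m p x0 x0).coeff k := by
    have h : renegarPoly m p x0 x0 =
        Polynomial.C (MvPolynomial.eval x0 p) * (Polynomial.X + 1) ^ m := by
      have hline : linePoly p x0 x0 = Polynomial.C (MvPolynomial.eval x0 p) := by
        refine Polynomial.funext fun t => ?_
        rw [eval_linePoly]
        simp
      rw [renegarPoly, hline, Polynomial.reflect_C]
      simp
    intro k hk
    rw [h, Polynomial.coeff_C_mul, Polynomial.coeff_X_add_one_pow]
    exact mul_pos hpos (by exact_mod_cast Nat.choose_pos hk)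
  have hcl : IsClosed {y | ∀ k ≤ m, 0 ≤ (renegarPoly m p x0 y).coeff k} := by
    simp only [Set.ofPred_forall]
    exact isClosed_iInter fun k => isClosed_iInter fun _ => isClosed_le continuous_const (hcont k)
  have hop : IsOpen {y | ∀ k ≤ m, 0 < (renegarPoly m p x0 y).coeff k} := by
    have h : {y | ∀ k ≤ m, 0 < (renegarPoly m p x0 y).coeff k} =
        ⋂ k ∈ Finset.range (m + 1), {y | 0 < (renegarPoly m p x0 y).coeff k} := by
      ext
      simp
    rw [h]
    exact isOpen_biInter_finset fun k _ => isOpen_lt continuous_const (hcont k)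
  refine isPreconnected_connectedComponentIn.subset_of_closure_inter_subset hop
    ⟨x0, mem_connectedComponentIn hpos, hx0⟩ ?_ hx
  rintro y ⟨hy, hyS⟩
  refine hstrict (connectedComponentIn_subset {z | 0 < MvPolynomial.eval z p} x0 hyS) ?_
  exact closure_minimal (fun z hz k hk => (hz k hk).le) hcl hy

/-- If `p` is positive on the half-open segment `[x0, x)` then `x` lies in the closure of the
connected component of `x0` in `{p > 0}`. -/
theorem mem_closure_component_of_linePoly_pos {d : ℕ} {p : MvPolynomial (Fin d) ℝ}
    {x0 x : Fin d → ℝ} (h : ∀ t ∈ Set.Ico (0 : ℝ) 1, 0 < (linePoly p x0 x).eval t) :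
    x ∈ closure (connectedComponentIn {x : Fin d → ℝ | 0 < MvPolynomial.eval x p} x0) := by
  let γ : ℝ → Fin d → ℝ := fun t i => x0 i + t * (x i - x0 i)
  have hγ : Continuous γ := by fun_prop
  have hγ0 : γ 0 = x0 := by simp [γ]
  have hγ1 : γ 1 = x := by simp [γ]
  have hsub : γ '' Set.Ico 0 1 ⊆
      connectedComponentIn {x : Fin d → ℝ | 0 < MvPolynomial.eval x p} x0 := by
    refine (isPreconnected_Ico.image γ hγ.continuousOn).subset_connectedComponentIn
      ⟨0, by simp, hγ0⟩ ?_
    rintro _ ⟨t, ht, rfl⟩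
    have := h t ht
    rwa [eval_linePoly] at this
  refine closure_mono hsub (image_closure_subset_closure_image hγ ⟨1, ?_, hγ1⟩)
  rw [closure_Ico zero_ne_one]
  simp

/-- For an `RZ_{x⁰}` polynomial `p` of degree `m` with `p(x⁰) > 0`, the closure of
the connected component of `x⁰` in `{p > 0}` equals the basic closed semialgebraic
set `{x : p(x) ≥ 0, p^{(1)}_{x⁰}(x) ≥ 0, …, p^{(m-1)}_{x⁰}(x) ≥ 0}`. -/
theorem stmt6 {d m : ℕ} (p : MvPolynomial (Fin d) ℝ) (x0 : Fin d → ℝ)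
    (hdeg : p.totalDegree = m) (hRZ : IsRZ p x0)
    (hpos : 0 < MvPolynomial.eval x0 p) :
    closure (connectedComponentIn
        {x : Fin d → ℝ | 0 < MvPolynomial.eval x p} x0) =
      {x : Fin d → ℝ | 0 ≤ MvPolynomial.eval x p ∧
        ∀ k ∈ Finset.Icc 1 (m - 1),
          0 ≤ MvPolynomial.eval x (renegarDeriv m p x0 k)} := by
  have hdeg' := hdeg.le
  refine Set.Subset.antisymm (closure_minimal (fun x hx => ?_) ?_) fun x hx => ?_
  · refine (renegar_nonneg_iff p hdeg' hpos x).2 fun k => ?_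
    rcases le_or_gt k m with hk | hk
    · exact (coeff_renegarPoly_pos_of_mem_component hdeg' hRZ hpos hx k hk).le
    · rw [Polynomial.coeff_eq_zero_of_natDegree_lt
        ((natDegree_renegarPoly_le p hdeg' x0 x).trans_lt hk)]
  · simp only [Set.ofPred_and, Set.ofPred_forall]
    exact (isClosed_le continuous_const (MvPolynomial.continuous_eval _)).inter
      (isClosed_iInter fun k => isClosed_iInter fun _ =>
        isClosed_le continuous_const (MvPolynomial.continuous_eval _))
  · have hnn := (renegar_nonneg_iff p hdeg' hpos x).1 hx
    refine mem_closure_component_of_linePoly_pos fun t ht => ?_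
    rcases ht.1.eq_or_lt with rfl | ht0
    · simpa [eval_linePoly] using hpos
    have hs : 0 < t⁻¹ - 1 := sub_pos.2 ((one_lt_inv₀ ht0).2 ht.2)
    have h := Polynomial.eval_pos_of_coeff_nonneg hnn (m := m)
      (by rwa [coeff_renegarPoly_self p hdeg']) hs
    rw [eval_renegarPoly p hdeg' x0 x (by simpa using ht0.ne')] at h
    simp only [sub_add_cancel, inv_inv] at h
    exact pos_of_mul_pos_right h (by positivity)
end
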